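/- arXiv:1111.1150 — 2 statements merged into one kernel-verified Lean document; each statement's English description precedes it below -/
import Mathlib

section
/- Let C_ℓ be a lattice cube determined by an orthogonal matrix (1/ℓ)·[[a₁,b₁,c₁],[a₂,b₂,c₂],[a₃,b₃,c₃]] with integer entries aᵢ,bᵢ,cᵢ satisfying aᵢaⱼ+bᵢbⱼ+cᵢcⱼ = δᵢⱼ·ℓ² for all i,j. Then the coefficient of t² in the Ehrhart polynomial L(C_ℓ,t) = ℓ³t³ + λ₁t² + λ₂t + 1 equals ℓ(d₁+d₂+d₃), where dᵢ = gcd(aᵢ,bᵢ,cᵢ). -/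
open Pointwise

/-- Number of lattice points of ℤ³ in the dilate `t•C` of the lattice cube (parallelepiped)
with a vertex at the origin and edge vectors `v₁ v₂ v₃`. -/
noncomputable def cubeCount (v₁ v₂ v₃ : Fin 3 → ℤ) (t : ℕ) : ℕ :=
  Set.ncard {p : Fin 3 → ℤ | ∃ x y z : ℝ, x ∈ Set.Icc (0 : ℝ) t ∧ y ∈ Set.Icc (0 : ℝ) t ∧
    z ∈ Set.Icc (0 : ℝ) t ∧ ∀ k, (p k : ℝ) = x * v₁ k + y * v₂ k + z * v₃ k}

/-- gcd of the three coordinates of an integer vector. -/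
def gcd3 (v : Fin 3 → ℤ) : ℕ := Int.gcd (v 0) (Int.gcd (v 1) (v 2))

/-- Dot product of integer vectors in ℤ³. -/
def dot3 (u v : Fin 3 → ℤ) : ℤ := u 0 * v 0 + u 1 * v 1 + u 2 * v 2


/-- The hypothesis that three integer vectors span a lattice cube of edge length `l`. -/
structure IsCube (l : ℤ) (v₁ v₂ v₃ : Fin 3 → ℤ) : Prop where
  pos : 0 < l
  h11 : dot3 v₁ v₁ = l ^ 2
  h22 : dot3 v₂ v₂ = l ^ 2
  h33 : dot3 v₃ v₃ = l ^ 2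
  h12 : dot3 v₁ v₂ = 0
  h13 : dot3 v₁ v₃ = 0
  h23 : dot3 v₂ v₃ = 0

theorem dot3_comm (u v : Fin 3 → ℤ) : dot3 u v = dot3 v u := by
  unfold dot3; ring

theorem dot3_add (p q v : Fin 3 → ℤ) : dot3 (p + q) v = dot3 p v + dot3 q v := by
  simp only [dot3, Pi.add_apply]; ring

theorem dot3_sub (p q v : Fin 3 → ℤ) : dot3 (p - q) v = dot3 p v - dot3 q v := by
  simp only [dot3, Pi.sub_apply]; ring

theorem dot3_smul (a : ℤ) (q v : Fin 3 → ℤ) : dot3 (a • q) v = a * dot3 q v := by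
  simp only [dot3, Pi.smul_apply, smul_eq_mul]; ring

theorem dot3_smul_right (a : ℤ) (q v : Fin 3 → ℤ) : dot3 q (a • v) = a * dot3 q v := by
  simp only [dot3, Pi.smul_apply, smul_eq_mul]; ring

namespace IsCube

variable {l : ℤ} {v₁ v₂ v₃ : Fin 3 → ℤ}

theorem swap12 (h : IsCube l v₁ v₂ v₃) : IsCube l v₂ v₁ v₃ :=
  ⟨h.pos, h.h22, h.h11, h.h33, (dot3_comm _ _).trans h.h12, h.h23, h.h13⟩

theorem swap23 (h : IsCube l v₁ v₂ v₃) : IsCube l v₁ v₃ v₂ :=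
  ⟨h.pos, h.h11, h.h33, h.h22, h.h13, h.h12, (dot3_comm _ _).trans h.h23⟩

theorem h21 (h : IsCube l v₁ v₂ v₃) : dot3 v₂ v₁ = 0 := (dot3_comm _ _).trans h.h12
theorem h31 (h : IsCube l v₁ v₂ v₃) : dot3 v₃ v₁ = 0 := (dot3_comm _ _).trans h.h13
theorem h32 (h : IsCube l v₁ v₂ v₃) : dot3 v₃ v₂ = 0 := (dot3_comm _ _).trans h.h23

theorem sq_pos (h : IsCube l v₁ v₂ v₃) : 0 < l ^ 2 := pow_pos h.pos 2

theorem mul_transpose (h : IsCube l v₁ v₂ v₃) :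
    Matrix.of ![v₁, v₂, v₃] * (Matrix.of ![v₁, v₂, v₃]).transpose
      = (l ^ 2) • (1 : Matrix (Fin 3) (Fin 3) ℤ) := by
  have := h.h11; have := h.h22; have := h.h33; have := h.h12; have := h.h13; have := h.h23
  have := h.h21; have := h.h31; have := h.h32
  ext i j
  simp only [dot3] at *
  fin_cases i <;> fin_cases j <;> simp [Matrix.mul_apply, Fin.sum_univ_three] <;> assumption

theorem det_sq (h : IsCube l v₁ v₂ v₃) : (Matrix.of ![v₁, v₂, v₃]).det ^ 2 = (l ^ 3) ^ 2 := by
  have := congrArg Matrix.det h.mul_transpose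
  rw [Matrix.det_mul, Matrix.det_transpose, Matrix.det_smul, Matrix.det_one] at this
  simp at this
  linear_combination this

theorem det_natAbs (h : IsCube l v₁ v₂ v₃) :
    ((Matrix.of ![v₁, v₂, v₃]).det.natAbs : ℤ) = l ^ 3 := by
  have := h.pos
  rw [Int.natCast_natAbs, (sq_eq_sq_iff_abs_eq_abs _ _).1 h.det_sq, abs_of_pos (by positivity)]

theorem det_ne (h : IsCube l v₁ v₂ v₃) : (Matrix.of ![v₁, v₂, v₃]).det ≠ 0 := by
  have := h.pos
  intro h0
  have h1 := h.det_natAbs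
  rw [h0] at h1
  have : 0 < l ^ 3 := by positivity
  simp at h1
  omega

/-- Expansion of a lattice point in the orthogonal frame. -/
theorem expand (h : IsCube l v₁ v₂ v₃) (p : Fin 3 → ℤ) :
    (l ^ 2) • p = dot3 p v₁ • v₁ + dot3 p v₂ • v₂ + dot3 p v₃ • v₃ := by
  set A := Matrix.of ![v₁, v₂, v₃] with hA
  have h1 : A.transpose * A = (l ^ 2) • (1 : Matrix (Fin 3) (Fin 3) ℤ) := by
    have hz : A * (A.transpose * A - (l ^ 2) • (1 : Matrix (Fin 3) (Fin 3) ℤ)) = 0 := by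
      rw [mul_sub, ← mul_assoc, h.mul_transpose, Matrix.smul_mul, Matrix.mul_smul, one_mul, mul_one,
        sub_self]
    have := congrArg (fun B => A.adjugate * B) hz
    simp only [← mul_assoc, Matrix.adjugate_mul, mul_zero] at this
    simp only [Matrix.smul_mul, one_mul] at this
    exact sub_eq_zero.1 ((smul_eq_zero.1 this).resolve_left h.det_ne)
  have h2 := congrArg (fun B => Matrix.mulVec B p) h1
  simp only [Matrix.smul_mulVec, Matrix.one_mulVec] at h2
  rw [← h2]
  ext k
  rw [← Matrix.mulVec_mulVec]
  simp [Matrix.mulVec, dotProduct, Fin.sum_univ_three, hA, dot3]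
  ring

theorem ext_dot (h : IsCube l v₁ v₂ v₃) {p q : Fin 3 → ℤ} (h1 : dot3 p v₁ = dot3 q v₁)
    (h2 : dot3 p v₂ = dot3 q v₂) (h3 : dot3 p v₃ = dot3 q v₃) : p = q := by
  have hp := h.expand p
  rw [h1, h2, h3, ← h.expand q] at hp
  exact smul_right_injective _ h.sq_pos.ne' hp

end IsCube

/-- Lattice points with prescribed dot products. -/
def dotBox (v₁ v₂ v₃ : Fin 3 → ℤ) (s₁ s₂ s₃ : Set ℤ) : Set (Fin 3 → ℤ) :=
  {p | dot3 p v₁ ∈ s₁ ∧ dot3 p v₂ ∈ s₂ ∧ dot3 p v₃ ∈ s₃}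

theorem dotBox_swap12 (v₁ v₂ v₃ : Fin 3 → ℤ) (s₁ s₂ s₃ : Set ℤ) :
    dotBox v₁ v₂ v₃ s₁ s₂ s₃ = dotBox v₂ v₁ v₃ s₂ s₁ s₃ := by
  ext p; simp only [dotBox, Set.mem_ofPred_eq]; tauto

theorem dotBox_swap23 (v₁ v₂ v₃ : Fin 3 → ℤ) (s₁ s₂ s₃ : Set ℤ) :
    dotBox v₁ v₂ v₃ s₁ s₂ s₃ = dotBox v₁ v₃ v₂ s₁ s₃ s₂ := by
  ext p; simp only [dotBox, Set.mem_ofPred_eq]; tauto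

namespace IsCube

variable {l : ℤ} {v₁ v₂ v₃ : Fin 3 → ℤ}

theorem finite_dotBox (h : IsCube l v₁ v₂ v₃) {s₁ s₂ s₃ : Set ℤ} (h1 : s₁.Finite)
    (h2 : s₂.Finite) (h3 : s₃.Finite) : (dotBox v₁ v₂ v₃ s₁ s₂ s₃).Finite := by
  refine Set.Finite.of_finite_image (f := fun p => (dot3 p v₁, dot3 p v₂, dot3 p v₃))
    ((h1.prod (h2.prod h3)).subset ?_) ?_
  · rintro _ ⟨p, hp, rfl⟩
    exact ⟨hp.1, hp.2.1, hp.2.2⟩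
  · intro p _ q _ hpq
    simp only [Prod.mk.injEq] at hpq
    exact h.ext_dot hpq.1 hpq.2.1 hpq.2.2

/-- Splitting off the far facet in the first direction. -/
theorem split (h : IsCube l v₁ v₂ v₃) {s₂ s₃ : Set ℤ} (h2 : s₂.Finite) (h3 : s₃.Finite) :
    (dotBox v₁ v₂ v₃ (Set.Icc 0 (l ^ 2)) s₂ s₃).ncard
      = (dotBox v₁ v₂ v₃ (Set.Ico 0 (l ^ 2)) s₂ s₃).ncard
        + (dotBox v₁ v₂ v₃ {0} s₂ s₃).ncard := by
  have hsq := h.sq_pos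
  have e1 : dotBox v₁ v₂ v₃ (Set.Icc 0 (l ^ 2)) s₂ s₃
      = dotBox v₁ v₂ v₃ (Set.Ico 0 (l ^ 2)) s₂ s₃ ∪ dotBox v₁ v₂ v₃ {l ^ 2} s₂ s₃ := by
    ext p
    have : dot3 p v₁ ∈ Set.Icc 0 (l ^ 2) ↔
        dot3 p v₁ ∈ Set.Ico 0 (l ^ 2) ∨ dot3 p v₁ ∈ ({l ^ 2} : Set ℤ) := by
      simp only [Set.mem_Icc, Set.mem_Ico, Set.mem_singleton_iff]; omega
    simp only [dotBox, Set.mem_union, Set.mem_ofPred_eq, this]; tauto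
  have e2 : (dotBox v₁ v₂ v₃ {0} s₂ s₃).ncard = (dotBox v₁ v₂ v₃ {l ^ 2} s₂ s₃).ncard := by
    refine Set.ncard_congr (fun p _ => p + v₁) ?_ ?_ ?_
    · rintro p ⟨a, b, c⟩
      simp only [Set.mem_singleton_iff] at a
      simp [-zsmul_eq_mul, dotBox, dot3_add, a, h.h11, h.h12, h.h13, b, c]
    · intro p q _ _ hpq
      exact add_right_cancel hpq
    · rintro p ⟨a, b, c⟩
      simp only [Set.mem_singleton_iff] at a
      refine ⟨p - v₁, ?_, by simp⟩
      simp [-zsmul_eq_mul, dotBox, dot3_sub, a, h.h11, h.h12, h.h13, b, c]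
  rw [e1, e2]
  refine Set.ncard_union_eq ?_ (h.finite_dotBox (Set.finite_Ico _ _) h2 h3)
    (h.finite_dotBox (Set.finite_singleton _) h2 h3)
  rw [Set.disjoint_left]
  rintro p ⟨a, -, -⟩ ⟨b, -, -⟩
  simp only [Set.mem_Ico, Set.mem_singleton_iff] at a b
  omega

/-- The fundamental half-open cube contains `l ^ 3` lattice points. -/
theorem count3 (h : IsCube l v₁ v₂ v₃) :
    ((dotBox v₁ v₂ v₃ (Set.Ico 0 (l ^ 2)) (Set.Ico 0 (l ^ 2)) (Set.Ico 0 (l ^ 2))).ncard : ℤ)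
      = l ^ 3 := by
  have hsq := h.sq_pos
  set A := Matrix.of ![v₁, v₂, v₃] with hA
  set f : (Fin 3 → ℤ) →ₗ[ℤ] (Fin 3 → ℤ) := Matrix.toLin' A.transpose with hf
  have hfx : ∀ x, f x = x 0 • v₁ + x 1 • v₂ + x 2 • v₃ := by
    intro x
    ext k
    simp [hf, Matrix.toLin'_apply, Matrix.mulVec, dotProduct, Fin.sum_univ_three, hA]
    ring
  have hd1 : ∀ x, dot3 (f x) v₁ = l ^ 2 * x 0 := by
    intro x; rw [hfx]; simp [-zsmul_eq_mul, dot3_add, dot3_smul, h.h11, h.h21, h.h31]; ring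
  have hd2 : ∀ x, dot3 (f x) v₂ = l ^ 2 * x 1 := by
    intro x; rw [hfx]; simp [-zsmul_eq_mul, dot3_add, dot3_smul, h.h22, h.h12, h.h32]; ring
  have hd3 : ∀ x, dot3 (f x) v₃ = l ^ 2 * x 2 := by
    intro x; rw [hfx]; simp [-zsmul_eq_mul, dot3_add, dot3_smul, h.h33, h.h13, h.h23]; ring
  have hinj : Function.Injective f := by
    intro x y hxy
    have a1 := hd1 x; have a2 := hd2 x; have a3 := hd3 x
    rw [hxy] at a1 a2 a3
    rw [hd1] at a1; rw [hd2] at a2; rw [hd3] at a3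
    ext k
    fin_cases k
    · exact (mul_left_cancel₀ hsq.ne' a1).symm
    · exact (mul_left_cancel₀ hsq.ne' a2).symm
    · exact (mul_left_cancel₀ hsq.ne' a3).symm
  have hcard : A.det.natAbs = Nat.card ((Fin 3 → ℤ) ⧸ LinearMap.range f) := by
    rw [← Submodule.natAbs_det_equiv (LinearMap.range f) (LinearEquiv.ofInjective f hinj)]
    have : (LinearMap.range f).subtype ∘ₗ AddMonoidHom.toIntLinearMap
        ((LinearEquiv.ofInjective f hinj : (Fin 3 → ℤ) ≃ₗ[ℤ] LinearMap.range f) :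
          (Fin 3 → ℤ) →+ LinearMap.range f) = f := by
      ext; rfl
    rw [this, hf, LinearMap.det_toLin', Matrix.det_transpose]
  rw [← h.det_natAbs, ← hA, hcard]
  congr 1
  rw [← Nat.card_coe_set_eq]
  refine Nat.card_eq_of_bijective
    (fun p => (Submodule.Quotient.mk p.1 : (Fin 3 → ℤ) ⧸ LinearMap.range f)) ⟨?_, ?_⟩
  · rintro ⟨p, hp1, hp2, hp3⟩ ⟨q, hq1, hq2, hq3⟩ hpq
    simp only [Submodule.Quotient.eq, LinearMap.mem_range] at hpq
    obtain ⟨x, hx⟩ := hpq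
    have key : ∀ a b c : ℤ, a ∈ Set.Ico 0 (l ^ 2) → b ∈ Set.Ico 0 (l ^ 2) → a - b = l ^ 2 * c →
        a = b := by
      intro a b c ha hb hab
      have h1 := Int.emod_eq_of_lt ha.1 ha.2
      have h2 := Int.emod_eq_of_lt hb.1 hb.2
      rw [← h1, ← h2]
      exact Int.emod_emod_of_dvd a (dvd_refl _) ▸ (Int.emod_emod_of_dvd b (dvd_refl (l^2))) ▸
        Int.emod_eq_emod_iff_emod_sub_eq_zero.2 (by rw [h1, h2, hab]; simp)
    apply Subtype.ext
    refine h.ext_dot (key _ _ (x 0) hp1 hq1 ?_) (key _ _ (x 1) hp2 hq2 ?_) (key _ _ (x 2) hp3 hq3 ?_)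
    · rw [← dot3_sub, ← hx, hd1]
    · rw [← dot3_sub, ← hx, hd2]
    · rw [← dot3_sub, ← hx, hd3]
  · intro y
    obtain ⟨p, rfl⟩ := Submodule.Quotient.mk_surjective _ y
    have key : ∀ a : ℤ, a - l ^ 2 * (a / l ^ 2) ∈ Set.Ico 0 (l ^ 2) := by
      intro a
      rw [← Int.emod_def]
      exact ⟨Int.emod_nonneg _ hsq.ne', Int.emod_lt_of_pos _ hsq⟩
    set x : Fin 3 → ℤ := ![dot3 p v₁ / l ^ 2, dot3 p v₂ / l ^ 2, dot3 p v₃ / l ^ 2] with hx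
    refine ⟨⟨p - f x, ?_, ?_, ?_⟩, ?_⟩
    · rw [dot3_sub, hd1]; exact key _
    · rw [dot3_sub, hd2]; exact key _
    · rw [dot3_sub, hd3]; exact key _
    · simp only [Submodule.Quotient.eq, LinearMap.mem_range]
      exact ⟨-x, by simp⟩

end IsCube

theorem gcd3_dvd (v : Fin 3 → ℤ) (k : Fin 3) : (gcd3 v : ℤ) ∣ v k := by
  have h0 : (gcd3 v : ℤ) ∣ (Int.gcd (v 1) (v 2) : ℤ) := Int.gcd_dvd_right ..
  fin_cases k
  · exact Int.gcd_dvd_left ..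
  · exact h0.trans (Int.gcd_dvd_left ..)
  · exact h0.trans (Int.gcd_dvd_right ..)

theorem gcd3_dvd_dot (p v : Fin 3 → ℤ) : (gcd3 v : ℤ) ∣ dot3 p v := by
  unfold dot3
  exact dvd_add (dvd_add ((gcd3_dvd v 0).mul_left _) ((gcd3_dvd v 1).mul_left _))
    ((gcd3_dvd v 2).mul_left _)

theorem gcd3_bezout (v : Fin 3 → ℤ) : ∃ u, dot3 u v = gcd3 v := by
  have h1 := Int.gcd_eq_gcd_ab (v 1) (v 2)
  have h2 := Int.gcd_eq_gcd_ab (v 0) (Int.gcd (v 1) (v 2))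
  refine ⟨![Int.gcdA (v 0) (Int.gcd (v 1) (v 2)),
    Int.gcdA (v 1) (v 2) * Int.gcdB (v 0) (Int.gcd (v 1) (v 2)),
    Int.gcdB (v 1) (v 2) * Int.gcdB (v 0) (Int.gcd (v 1) (v 2))], ?_⟩
  rw [gcd3, h2]
  simp only [dot3, Matrix.cons_val]
  linear_combination (-Int.gcdB (v 0) (Int.gcd (v 1) (v 2))) * h1

theorem gcd3_smul (t : ℕ) (v : Fin 3 → ℤ) : gcd3 ((t : ℤ) • v) = t * gcd3 v := by
  simp only [gcd3, Pi.smul_apply, smul_eq_mul, Int.gcd_mul_left, Int.natAbs_natCast]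
  rw [Nat.cast_mul, Int.gcd_mul_left, Int.natAbs_natCast]

namespace IsCube

variable {l : ℤ} {v₁ v₂ v₃ : Fin 3 → ℤ}

theorem gcd_pos (h : IsCube l v₁ v₂ v₃) : 0 < gcd3 v₃ := by
  rcases Nat.eq_zero_or_pos (gcd3 v₃) with h0 | h0
  · exfalso
    have := gcd3_dvd_dot v₃ v₃
    rw [h0, h.h33, Nat.cast_zero, zero_dvd_iff] at this
    exact h.sq_pos.ne' this
  · exact h0

/-- Reduction modulo the first two edge vectors. -/
def red (l : ℤ) (v₁ v₂ p : Fin 3 → ℤ) : Fin 3 → ℤ :=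
  p - ((dot3 p v₁ / l ^ 2) • v₁ + (dot3 p v₂ / l ^ 2) • v₂)

theorem red1 (h : IsCube l v₁ v₂ v₃) (p : Fin 3 → ℤ) :
    dot3 (red l v₁ v₂ p) v₁ = dot3 p v₁ % l ^ 2 := by
  simp [-zsmul_eq_mul, red, dot3_sub, dot3_add, dot3_smul, h.h11, h.h21, Int.emod_def]; ring

theorem red2 (h : IsCube l v₁ v₂ v₃) (p : Fin 3 → ℤ) :
    dot3 (red l v₁ v₂ p) v₂ = dot3 p v₂ % l ^ 2 := by
  simp [-zsmul_eq_mul, red, dot3_sub, dot3_add, dot3_smul, h.h12, h.h22, Int.emod_def]; ring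

theorem red3 (h : IsCube l v₁ v₂ v₃) (p : Fin 3 → ℤ) :
    dot3 (red l v₁ v₂ p) v₃ = dot3 p v₃ := by
  simp [-zsmul_eq_mul, red, dot3_sub, dot3_add, dot3_smul, h.h13, h.h23]

theorem count2 (h : IsCube l v₁ v₂ v₃) :
    ((dotBox v₁ v₂ v₃ (Set.Ico 0 (l ^ 2)) (Set.Ico 0 (l ^ 2)) {0}).ncard : ℤ)
      = l * gcd3 v₃ := by
  have hsq := h.sq_pos
  have hmod : ∀ a : ℤ, a % l ^ 2 ∈ Set.Ico 0 (l ^ 2) := fun a =>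
    ⟨Int.emod_nonneg _ hsq.ne', Int.emod_lt_of_pos _ hsq⟩
  have hd : (0 : ℤ) < gcd3 v₃ := by exact_mod_cast h.gcd_pos
  obtain ⟨u, hu⟩ := gcd3_bezout v₃
  obtain ⟨m, hm⟩ : (gcd3 v₃ : ℤ) ∣ l ^ 2 := h.h33 ▸ gcd3_dvd_dot v₃ v₃
  set d : ℤ := ((gcd3 v₃ : ℕ) : ℤ) with hdd
  have hmpos : 0 < m := by
    rw [hm] at hsq
    exact (mul_pos_iff_of_pos_left hd).1 hsq
  have hcong : (dotBox v₁ v₂ v₃ (Set.Ico 0 (l ^ 2)) (Set.Ico 0 (l ^ 2)) {0}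
        ×ˢ Set.Ico 0 m).ncard
      = (dotBox v₁ v₂ v₃ (Set.Ico 0 (l ^ 2)) (Set.Ico 0 (l ^ 2)) (Set.Ico 0 (l ^ 2))).ncard := by
    refine Set.ncard_congr (fun x _ => red l v₁ v₂ (x.1 + x.2 • u)) ?_ ?_ ?_
    · rintro ⟨p, k⟩ ⟨⟨-, -, hp3⟩, hk0, hkm⟩
      simp only [Set.mem_singleton_iff] at hp3 hk0 hkm
      refine ⟨?_, ?_, ?_⟩
      · simp only [h.red1]; exact hmod _
      · simp only [h.red2]; exact hmod _
      · simp only [h.red3, dot3_add, dot3_smul, hp3, hu]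
        rw [hm]
        constructor <;> nlinarith
    · rintro ⟨p, k⟩ ⟨q, j⟩ ⟨⟨hp1, hp2, hp3⟩, -⟩ ⟨⟨hq1, hq2, hq3⟩, -⟩ he
      simp only [Set.mem_singleton_iff] at hp3 hq3 he
      have e1 := congrArg (fun p => dot3 p v₁) he
      have e2 := congrArg (fun p => dot3 p v₂) he
      have e3 := congrArg (fun p => dot3 p v₃) he
      simp only [h.red1, h.red2, h.red3, dot3_add, dot3_smul, hp3, hq3, hu, zero_add] at e1 e2 e3
      have hkj : k = j := mul_right_cancel₀ hd.ne' e3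
      subst hkj
      have f1 := Int.ModEq.add_right_cancel' _ e1
      have f2 := Int.ModEq.add_right_cancel' _ e2
      have g1 : dot3 p v₁ = dot3 q v₁ := by
        rw [← Int.emod_eq_of_lt hp1.1 hp1.2, ← Int.emod_eq_of_lt hq1.1 hq1.2]; exact f1
      have g2 : dot3 p v₂ = dot3 q v₂ := by
        rw [← Int.emod_eq_of_lt hp2.1 hp2.2, ← Int.emod_eq_of_lt hq2.1 hq2.2]; exact f2
      rw [h.ext_dot g1 g2 (hp3.trans hq3.symm)]
    · rintro p ⟨hp1, hp2, hp3⟩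
      obtain ⟨k, hk⟩ : d ∣ dot3 p v₃ := gcd3_dvd_dot p v₃
      rw [hk, hm] at hp3
      refine ⟨(red l v₁ v₂ (p - k • u), k), ⟨⟨?_, ?_, ?_⟩, ?_, ?_⟩, ?_⟩
      · simp only [h.red1]; exact hmod _
      · simp only [h.red2]; exact hmod _
      · simp only [h.red3, dot3_sub, dot3_smul, hu, hk, Set.mem_singleton_iff]; ring
      · exact nonneg_of_mul_nonneg_right hp3.1 hd
      · exact lt_of_mul_lt_mul_left hp3.2 hd.le
      · refine h.ext_dot ?_ ?_ ?_
        · simp [-zsmul_eq_mul, h.red1, dot3_add, dot3_sub, Int.emod_eq_of_lt hp1.1 hp1.2]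
        · simp [-zsmul_eq_mul, h.red2, dot3_add, dot3_sub, Int.emod_eq_of_lt hp2.1 hp2.2]
        · simp [-zsmul_eq_mul, h.red3, dot3_add, dot3_sub]
  have h3 := h.count3
  have hmc : ((Set.Ico 0 m).ncard : ℤ) = m := by
    rw [← Finset.coe_Ico, Set.ncard_coe_finset, Int.card_Ico]; omega
  rw [← hcong, Set.ncard_prod, Nat.cast_mul, hmc] at h3
  apply mul_right_cancel₀ hmpos.ne'
  rw [h3, mul_assoc, ← hm]; ring

theorem count1 (h : IsCube l v₁ v₂ v₃) :
    (dotBox v₁ v₂ v₃ {0} {0} (Set.Ico 0 (l ^ 2))).ncard = gcd3 v₃ := by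
  have hsq := h.sq_pos
  have hd : (0 : ℤ) < gcd3 v₃ := by exact_mod_cast h.gcd_pos
  obtain ⟨u, hu⟩ := gcd3_bezout v₃
  choose w hw using gcd3_dvd v₃
  have hw' : v₃ = (gcd3 v₃ : ℤ) • w := funext hw
  obtain ⟨m, hm⟩ : (gcd3 v₃ : ℤ) ∣ l ^ 2 := h.h33 ▸ gcd3_dvd_dot v₃ v₃
  have hmpos : 0 < m := by
    rw [hm] at hsq
    exact (mul_pos_iff_of_pos_left hd).1 hsq
  have w3 : dot3 w v₃ = m := by
    have := h.h33
    nth_rewrite 1 [hw'] at this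
    rw [dot3_smul, hm] at this
    exact mul_left_cancel₀ hd.ne' this
  have w1 : dot3 w v₁ = 0 := by
    have := h.h31
    rw [hw', dot3_smul] at this
    exact (mul_eq_zero.1 this).resolve_left hd.ne'
  have w2 : dot3 w v₂ = 0 := by
    have := h.h32
    rw [hw', dot3_smul] at this
    exact (mul_eq_zero.1 this).resolve_left hd.ne'
  have huw : dot3 w u = 1 := by
    have hu' : dot3 u ((gcd3 v₃ : ℤ) • w) = gcd3 v₃ := by rw [← hw']; exact hu
    rw [dot3_smul_right] at hu'
    exact mul_left_cancel₀ hd.ne' (by rw [mul_one, dot3_comm]; exact hu')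
  have hcong : (Set.Ico 0 (gcd3 v₃ : ℤ)).ncard
      = (dotBox v₁ v₂ v₃ {0} {0} (Set.Ico 0 (l ^ 2))).ncard := by
    refine Set.ncard_congr (fun k _ => k • w) ?_ ?_ ?_
    · rintro k ⟨hk0, hk1⟩
      refine ⟨by simp [-zsmul_eq_mul, dot3_smul, w1], by simp [-zsmul_eq_mul, dot3_smul, w2], ?_⟩
      simp only [dot3_smul, w3, hm]
      constructor <;> nlinarith
    · intro k j _ _ he
      have := congrArg (fun p => dot3 p u) he
      simpa only [dot3_smul, huw, mul_one] using this
    · rintro p ⟨hp1, hp2, hp3⟩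
      simp only [Set.mem_singleton_iff] at hp1 hp2
      have he := h.expand p
      rw [hp1, hp2] at he
      have he' := congrArg (fun p => dot3 p u) he
      simp only [dot3_add, dot3_smul, zero_mul, zero_add] at he'
      rw [dot3_comm v₃ u, hu, hm] at he'
      have h3 : dot3 p v₃ = dot3 p u * m := by
        apply mul_right_cancel₀ hd.ne'
        linear_combination -he'
      rw [h3, hm, mul_comm (dot3 p u) m] at hp3
      refine ⟨dot3 p u, ⟨nonneg_of_mul_nonneg_right hp3.1 hmpos, ?_⟩, ?_⟩
      · refine lt_of_mul_lt_mul_left (a := m) ?_ hmpos.le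
        rw [mul_comm m (gcd3 v₃ : ℤ)]; exact hp3.2
      · refine h.ext_dot ?_ ?_ ?_
        · rw [dot3_smul, w1, hp1, mul_zero]
        · rw [dot3_smul, w2, hp2, mul_zero]
        · rw [dot3_smul, w3, h3]
  rw [← hcong, ← Finset.coe_Ico, Set.ncard_coe_finset, Int.card_Ico]; simp

theorem count0 (h : IsCube l v₁ v₂ v₃) :
    (dotBox v₁ v₂ v₃ {0} {0} {0}).ncard = 1 := by
  rw [Set.ncard_eq_one]
  refine ⟨0, ?_⟩
  ext p
  have hz : ∀ v, dot3 0 v = 0 := by intro v; simp [dot3]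
  constructor
  · rintro ⟨h1, h2, h3⟩
    exact h.ext_dot (by rw [h1, hz]) (by rw [h2, hz]) (by rw [h3, hz])
  · rintro rfl
    exact ⟨hz _, hz _, hz _⟩

/-- The number of lattice points in a closed lattice cube. -/
theorem count_closed (h : IsCube l v₁ v₂ v₃) :
    ((dotBox v₁ v₂ v₃ (Set.Icc 0 (l ^ 2)) (Set.Icc 0 (l ^ 2)) (Set.Icc 0 (l ^ 2))).ncard : ℤ)
      = l ^ 3 + l * (gcd3 v₁ + gcd3 v₂ + gcd3 v₃) + (gcd3 v₁ + gcd3 v₂ + gcd3 v₃) + 1 := by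
  have fC : (Set.Icc 0 (l ^ 2)).Finite := Set.finite_Icc _ _
  have fO : (Set.Ico 0 (l ^ 2)).Finite := Set.finite_Ico _ _
  have f0 : ({0} : Set ℤ).Finite := Set.finite_singleton _
  have s2 : ∀ {s₁ s₃ : Set ℤ}, s₁.Finite → s₃.Finite →
      (dotBox v₁ v₂ v₃ s₁ (Set.Icc 0 (l ^ 2)) s₃).ncard
      = (dotBox v₁ v₂ v₃ s₁ (Set.Ico 0 (l ^ 2)) s₃).ncard
        + (dotBox v₁ v₂ v₃ s₁ {0} s₃).ncard := by
    intro s₁ s₃ a b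
    simp only [dotBox_swap12 v₁]
    exact h.swap12.split a b
  have s3 : ∀ {s₁ s₂ : Set ℤ}, s₁.Finite → s₂.Finite →
      (dotBox v₁ v₂ v₃ s₁ s₂ (Set.Icc 0 (l ^ 2))).ncard
      = (dotBox v₁ v₂ v₃ s₁ s₂ (Set.Ico 0 (l ^ 2))).ncard
        + (dotBox v₁ v₂ v₃ s₁ s₂ {0}).ncard := by
    intro s₁ s₂ a b
    simp only [dotBox_swap23 v₁ v₂ v₃, dotBox_swap12 v₁ v₃]
    exact h.swap23.swap12.split a b
  rw [h.split fC fC, s2 fO fC, s2 f0 fC, s3 fO fO, s3 fO f0, s3 f0 fO, s3 f0 f0, h.count0, h.count1]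
  have a3 := h.count3
  have a12 := h.count2
  have a13 := h.swap23.count2
  have a23 := h.swap12.swap23.count2
  have a1 := h.swap12.swap23.count1
  have a2 := h.swap23.count1
  rw [dotBox_swap23] at a13 a2
  rw [dotBox_swap23, dotBox_swap12] at a23 a1
  push_cast
  rw [a3, a12, a13, a23, a1, a2]
  ring

end IsCube

theorem cubeCount_eq (l : ℤ) (v₁ v₂ v₃ : Fin 3 → ℤ) (h : IsCube l v₁ v₂ v₃) (t : ℕ) (ht : 0 < t) :
    cubeCount v₁ v₂ v₃ t = (dotBox ((t : ℤ) • v₁) ((t : ℤ) • v₂) ((t : ℤ) • v₃)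
      (Set.Icc 0 ((t * l) ^ 2)) (Set.Icc 0 ((t * l) ^ 2)) (Set.Icc 0 ((t * l) ^ 2))).ncard := by
  have hsq := h.sq_pos
  have hsqR : (0 : ℝ) < (l : ℝ) ^ 2 := by exact_mod_cast hsq
  have hlR : (l : ℝ) ≠ 0 := by exact_mod_cast h.pos.ne'
  have htR : (0 : ℝ) < (t : ℝ) := by exact_mod_cast ht
  have tr : ∀ (a : ℤ) (x : ℝ), (a : ℝ) = x * (l : ℝ) ^ 2 →
      (x ∈ Set.Icc (0 : ℝ) t ↔ (t : ℤ) * a ∈ Set.Icc (0 : ℤ) ((t * l) ^ 2)) := by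
    intro a x hx
    have e1 : (0 : ℤ) ≤ t * a ↔ (0 : ℝ) ≤ x := by
      rw [← Int.cast_le (R := ℝ)]
      push_cast
      rw [hx, mul_nonneg_iff_of_pos_left htR, mul_nonneg_iff_of_pos_right hsqR]
    have e2 : (t : ℤ) * a ≤ (t * l) ^ 2 ↔ x ≤ t := by
      rw [← Int.cast_le (R := ℝ)]
      push_cast
      rw [hx, show ((t : ℝ) * l) ^ 2 = t * (t * (l : ℝ) ^ 2) by ring,
        mul_le_mul_iff_right₀ htR, mul_le_mul_iff_left₀ hsqR]
    simp only [Set.mem_Icc, e1, e2]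
  unfold cubeCount
  congr 1
  ext p
  simp only [dotBox, Set.mem_ofPred_eq, dot3_smul_right]
  constructor
  · rintro ⟨x, y, z, hx, hy, hz, hp⟩
    have gen : ∀ v : Fin 3 → ℤ, (dot3 p v : ℝ) = x * (dot3 v₁ v : ℤ) + y * (dot3 v₂ v : ℤ)
        + z * (dot3 v₃ v : ℤ) := by
      intro v
      simp only [dot3]
      push_cast
      rw [hp, hp, hp]; ring
    refine ⟨(tr _ x ?_).1 hx, (tr _ y ?_).1 hy, (tr _ z ?_).1 hz⟩
    · rw [gen, h.h11, h.h21, h.h31]; push_cast; ring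
    · rw [gen, h.h12, h.h22, h.h32]; push_cast; ring
    · rw [gen, h.h13, h.h23, h.h33]; push_cast; ring
  · rintro ⟨h1, h2, h3⟩
    refine ⟨dot3 p v₁ / (l : ℝ) ^ 2, dot3 p v₂ / (l : ℝ) ^ 2, dot3 p v₃ / (l : ℝ) ^ 2,
      (tr _ _ ?_).2 h1, (tr _ _ ?_).2 h2, (tr _ _ ?_).2 h3, ?_⟩
    · field_simp
    · field_simp
    · field_simp
    · intro k
      have := congrArg (fun q => ((q k : ℤ) : ℝ)) (h.expand p)
      simp only [Pi.add_apply, Pi.smul_apply, smul_eq_mul] at this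
      push_cast at this
      field_simp
      linear_combination this

theorem cube_ehrhart_quadratic_coeff (ℓ : ℤ) (hℓ : 0 < ℓ) (v₁ v₂ v₃ : Fin 3 → ℤ)
    (h11 : dot3 v₁ v₁ = ℓ ^ 2) (h22 : dot3 v₂ v₂ = ℓ ^ 2) (h33 : dot3 v₃ v₃ = ℓ ^ 2)
    (h12 : dot3 v₁ v₂ = 0) (h13 : dot3 v₁ v₃ = 0) (h23 : dot3 v₂ v₃ = 0) :
    ∃ lam₂ : ℚ, ∀ t : ℕ, 0 < t →
      (cubeCount v₁ v₂ v₃ t : ℚ) =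
        (ℓ : ℚ) ^ 3 * t ^ 3 + (ℓ : ℚ) * ((gcd3 v₁ : ℚ) + gcd3 v₂ + gcd3 v₃) * t ^ 2
          + lam₂ * t + 1 := by
  refine ⟨(gcd3 v₁ : ℚ) + gcd3 v₂ + gcd3 v₃, fun t ht => ?_⟩
  have h : IsCube ℓ v₁ v₂ v₃ := ⟨hℓ, h11, h22, h33, h12, h13, h23⟩
  have htZ : (0 : ℤ) < t := by exact_mod_cast ht
  have h' : IsCube (t * ℓ) ((t : ℤ) • v₁) ((t : ℤ) • v₂) ((t : ℤ) • v₃) := by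
    refine ⟨mul_pos htZ hℓ, ?_, ?_, ?_, ?_, ?_, ?_⟩ <;>
      simp only [dot3_smul, dot3_smul_right, h11, h22, h33, h12, h13, h23] <;> ring
  have hc := h'.count_closed
  rw [← cubeCount_eq ℓ v₁ v₂ v₃ h t ht, gcd3_smul, gcd3_smul, gcd3_smul] at hc
  have hq := congrArg (fun z : ℤ => (z : ℚ)) hc
  push_cast at hq
  rw [hq]
  ring
end

section
/- Let C_ℓ be a lattice cube with pairwise orthogonal integer edge vectors (a₁,b₁,c₁), (a₂,b₂,c₂), (a₃,b₃,c₃) each of length ℓ, and dᵢ = gcd(aᵢ,bᵢ,cᵢ). Then its Ehrhart polynomial factors as L(C_ℓ,t) = (ℓt+1)(ℓ²t² + (d₁+d₂+d₃−ℓ)t + 1) for all integers t. -/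
open Pointwise

/-- Determinant of three integer vectors. -/
def D3 (a b c : Fin 3 → ℤ) : ℤ :=
  a 0 * (b 1 * c 2 - b 2 * c 1) - a 1 * (b 0 * c 2 - b 2 * c 0) + a 2 * (b 0 * c 1 - b 1 * c 0)

/-- Lattice points with coordinates in given sets. -/
def PP (I J K : Set ℝ) (a b c : Fin 3 → ℤ) : Set (Fin 3 → ℤ) :=
  {p | ∃ x y z : ℝ, x ∈ I ∧ y ∈ J ∧ z ∈ K ∧ ∀ k, (p k : ℝ) = x * a k + y * b k + z * c k}

lemma D3_rot (a b c : Fin 3 → ℤ) : D3 b c a = D3 a b c := by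
  unfold D3; ring

lemma PP_rot (I J K : Set ℝ) (a b c : Fin 3 → ℤ) : PP I J K a b c = PP J K I b c a := by
  ext p
  constructor
  · rintro ⟨x, y, z, hx, hy, hz, h⟩
    exact ⟨y, z, x, hy, hz, hx, fun k => by rw [h k]; ring⟩
  · rintro ⟨y, z, x, hy, hz, hx, h⟩
    exact ⟨x, y, z, hx, hy, hz, fun k => by rw [h k]; ring⟩

lemma PP_uniq_fst {a b c : Fin 3 → ℤ} (hD : D3 a b c ≠ 0) {x y z x' y' z' : ℝ}
    (h : ∀ k, x * a k + y * b k + z * c k = x' * a k + y' * b k + z' * c k) : x = x' := by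
  have hD' : ((D3 a b c : ℤ) : ℝ) ≠ 0 := by exact_mod_cast hD
  apply mul_right_cancel₀ hD'
  have h0 := h 0
  have h1 := h 1
  have h2 := h 2
  unfold D3
  push_cast
  linear_combination (b 1 * c 2 - b 2 * c 1 : ℝ) * h0 - (b 0 * c 2 - b 2 * c 0 : ℝ) * h1
    + (b 0 * c 1 - b 1 * c 0 : ℝ) * h2

lemma PP_uniq {a b c : Fin 3 → ℤ} (hD : D3 a b c ≠ 0) {x y z x' y' z' : ℝ}
    (h : ∀ k, x * a k + y * b k + z * c k = x' * a k + y' * b k + z' * c k) :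
    x = x' ∧ y = y' ∧ z = z' := by
  refine ⟨PP_uniq_fst hD h, ?_, ?_⟩
  · refine PP_uniq_fst (a := b) (b := c) (c := a) (by rwa [D3_rot]) (z := x) (y := z)
      (y' := z') (z' := x') fun k => by linarith [h k]
  · refine PP_uniq_fst (a := c) (b := a) (c := b) (by rwa [D3_rot, D3_rot]) (z := y) (y := x)
      (y' := x') (z' := y') fun k => by linarith [h k]

lemma PP_mono {I J K I' J' K' : Set ℝ} (hI : I ⊆ I') (hJ : J ⊆ J') (hK : K ⊆ K')
    (a b c : Fin 3 → ℤ) : PP I J K a b c ⊆ PP I' J' K' a b c := by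
  rintro p ⟨x, y, z, hx, hy, hz, h⟩
  exact ⟨x, y, z, hI hx, hJ hy, hK hz, h⟩

lemma PP_finite (t : ℕ) (a b c : Fin 3 → ℤ) :
    (PP (Set.Icc (0 : ℝ) t) (Set.Icc (0 : ℝ) t) (Set.Icc (0 : ℝ) t) a b c).Finite := by
  apply (Set.finite_Icc (fun k => -(t * (|a k| + |b k| + |c k|)) : Fin 3 → ℤ)
    (fun k => t * (|a k| + |b k| + |c k|))).subset
  rintro p ⟨x, y, z, hx, hy, hz, h⟩
  have key : ∀ (s : ℝ) (n : ℤ), s ∈ Set.Icc (0 : ℝ) t → |s * n| ≤ t * |(n : ℝ)| := by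
    intro s n hs
    rw [abs_mul, abs_of_nonneg hs.1]
    exact mul_le_mul_of_nonneg_right hs.2 (abs_nonneg _)
  have : ∀ k, |(p k : ℝ)| ≤ t * (|(a k : ℝ)| + |(b k : ℝ)| + |(c k : ℝ)|) := by
    intro k
    rw [h k]
    calc _ ≤ |x * a k| + |y * b k| + |z * c k| := abs_add_three _ _ _
      _ ≤ _ := by linarith [key x (a k) hx, key y (b k) hy, key z (c k) hz]
  have this' : ∀ k, |p k| ≤ t * (|a k| + |b k| + |c k|) := by
    intro k
    exact_mod_cast this k
  exact ⟨fun k => (abs_le.1 (this' k)).1, fun k => (abs_le.1 (this' k)).2⟩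

lemma PP_split (t : ℕ) (J K : Set ℝ) (a b c : Fin 3 → ℤ) (hD : D3 a b c ≠ 0)
    (hJ : J ⊆ Set.Icc (0 : ℝ) t) (hK : K ⊆ Set.Icc (0 : ℝ) t) :
    (PP (Set.Icc (0 : ℝ) t) J K a b c).ncard =
      (PP (Set.Ico (0 : ℝ) t) J K a b c).ncard + (PP {0} J K a b c).ncard := by
  have ht : (0 : ℝ) ≤ t := Nat.cast_nonneg t
  have e1 : PP (Set.Icc (0 : ℝ) t) J K a b c =
      PP (Set.Ico (0 : ℝ) t) J K a b c ∪ PP {(t : ℝ)} J K a b c := by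
    ext p
    constructor
    · rintro ⟨x, y, z, hx, hy, hz, h⟩
      rcases hx.2.lt_or_eq with h1 | h1
      · exact Or.inl ⟨x, y, z, ⟨hx.1, h1⟩, hy, hz, h⟩
      · exact Or.inr ⟨x, y, z, h1, hy, hz, h⟩
    · rintro (h | h)
      · exact PP_mono Set.Ico_subset_Icc_self subset_rfl subset_rfl _ _ _ h
      · exact PP_mono (by simp) subset_rfl subset_rfl _ _ _ h
  have e2 : PP {(t : ℝ)} J K a b c = (fun p => p + fun k => t * a k) '' PP {0} J K a b c := by
    ext p
    constructor
    · rintro ⟨x, y, z, hx, hy, hz, h⟩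
      refine ⟨fun k => p k - t * a k, ⟨0, y, z, rfl, hy, hz, fun k => ?_⟩, ?_⟩
      · rw [Set.mem_singleton_iff] at hx
        push_cast
        rw [h k, hx]; ring
      · ext k; simp
    · rintro ⟨q, ⟨x, y, z, hx, hy, hz, h⟩, rfl⟩
      refine ⟨t, y, z, rfl, hy, hz, fun k => ?_⟩
      rw [Set.mem_singleton_iff] at hx
      simp only [Pi.add_apply]
      push_cast
      rw [h k, hx]; ring
  have f1 : (PP (Set.Ico (0 : ℝ) t) J K a b c).Finite :=
    (PP_finite t a b c).subset (PP_mono Set.Ico_subset_Icc_self hJ hK _ _ _)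
  have f2 : (PP {(t : ℝ)} J K a b c).Finite :=
    (PP_finite t a b c).subset (PP_mono (by simp) hJ hK _ _ _)
  rw [e1, Set.ncard_union_eq ?_ f1 f2, e2,
    Set.ncard_image_of_injective _ (add_left_injective _)]
  · rw [Set.disjoint_left]
    rintro p ⟨x, y, z, hx, hy, hz, h⟩ ⟨x', y', z', hx', hy', hz', h'⟩
    have := PP_uniq_fst hD (fun k => (h k).symm.trans (h' k))
    rw [Set.mem_singleton_iff] at hx'
    linarith [hx.2]

lemma PP_unit (a b c : Fin 3 → ℤ) (hD : D3 a b c ≠ 0) :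
    (PP (Set.Ico (0 : ℝ) 1) (Set.Ico (0 : ℝ) 1) (Set.Ico (0 : ℝ) 1) a b c).ncard =
      (D3 a b c).natAbs := by
  have hD' : ((D3 a b c : ℤ) : ℝ) ≠ 0 := by exact_mod_cast hD
  let v : Fin 3 → (Fin 3 → ℤ) := ![a, b, c]
  have hdet : (Matrix.of v).det = D3 a b c := by
    rw [Matrix.det_fin_three]
    simp [v, D3]
    ring
  have hli : LinearIndependent ℤ v :=
    Matrix.linearIndependent_rows_of_det_ne_zero (A := Matrix.of v) (by rwa [hdet])
  have hcard := Submodule.natAbs_det_basis_change (Pi.basisFun ℤ (Fin 3))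
    (Submodule.span ℤ (Set.range v)) (Module.Basis.span hli)
  have hdet2 : (Pi.basisFun ℤ (Fin 3)).det ((↑) ∘ (Module.Basis.span hli)) = D3 a b c := by
    rw [← hdet, Pi.basisFun_det_apply]
    congr 1
    ext i j
    simp [Module.Basis.span_apply]
  rw [hdet2] at hcard
  rw [hcard]
  have hmem : ∀ q : Fin 3 → ℤ, q ∈ Submodule.span ℤ (Set.range v) ↔
      ∃ x y z : ℤ, ∀ k, q k = x * a k + y * b k + z * c k := by
    intro q
    rw [Submodule.mem_span_range_iff_exists_fun]
    constructor
    · rintro ⟨f, hf⟩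
      refine ⟨f 0, f 1, f 2, fun k => ?_⟩
      rw [← hf]
      simp [Fin.sum_univ_three, v]
    · rintro ⟨x, y, z, h⟩
      refine ⟨![x, y, z], ?_⟩
      ext k
      simp [Fin.sum_univ_three, v, h k]
  rw [← Nat.card_coe_set_eq]
  apply Nat.card_congr
  refine Equiv.ofBijective
    (fun p => Submodule.Quotient.mk (p := Submodule.span ℤ (Set.range v)) p.1) ⟨?_, ?_⟩
  · rintro ⟨p, x, y, z, hx, hy, hz, h⟩ ⟨p', x', y', z', hx', hy', hz', h'⟩ hpp
    rw [Submodule.Quotient.eq, hmem] at hpp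
    obtain ⟨m, n, r, hm⟩ := hpp
    have hu := PP_uniq hD (x := x - x') (y := y - y') (z := z - z') (x' := m) (y' := n)
      (z' := r) (fun k => by
        have := congrArg (Int.cast : ℤ → ℝ) (hm k)
        simp only [Pi.sub_apply] at this
        push_cast at this
        rw [h k, h' k] at this
        linarith)
    have key : ∀ (s s' : ℝ) (n : ℤ), s ∈ Set.Ico (0 : ℝ) 1 → s' ∈ Set.Ico (0 : ℝ) 1 →
        s - s' = n → n = 0 := by
      intro s s' n hs hs' e
      have h1 : (n : ℝ) < 1 := by linarith [hs.2, hs'.1]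
      have h2 : (-1 : ℝ) < n := by linarith [hs.1, hs'.2]
      have h1' : n < 1 := by exact_mod_cast h1
      have h2' : -1 < n := by exact_mod_cast h2
      omega
    have hm0 := key _ _ _ hx hx' hu.1
    have hn0 := key _ _ _ hy hy' hu.2.1
    have hr0 := key _ _ _ hz hz' hu.2.2
    apply Subtype.ext
    ext k
    have := hm k
    rw [hm0, hn0, hr0] at this
    simp only [Pi.sub_apply] at this
    change p k = p' k
    linarith
  · intro q
    obtain ⟨p, rfl⟩ := Submodule.Quotient.mk_surjective _ q
    obtain ⟨x, y, z, h⟩ : ∃ x y z : ℝ, ∀ k, (p k : ℝ) = x * a k + y * b k + z * c k := by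
      refine ⟨D3 p b c / D3 a b c, D3 a p c / D3 a b c, D3 a b p / D3 a b c, fun k => ?_⟩
      field_simp
      unfold D3
      push_cast
      fin_cases k <;> simp <;> ring
    refine ⟨⟨fun k => p k - (⌊x⌋ * a k + ⌊y⌋ * b k + ⌊z⌋ * c k), Int.fract x, Int.fract y,
      Int.fract z, ⟨Int.fract_nonneg _, Int.fract_lt_one _⟩,
      ⟨Int.fract_nonneg _, Int.fract_lt_one _⟩, ⟨Int.fract_nonneg _, Int.fract_lt_one _⟩,
      fun k => ?_⟩, ?_⟩
    · push_cast
      rw [h k]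
      simp only [Int.fract]
      ring
    · rw [Submodule.Quotient.eq, hmem]
      refine ⟨-⌊x⌋, -⌊y⌋, -⌊z⌋, fun k => ?_⟩
      simp only [Pi.sub_apply]
      ring

lemma scale_Ico {t : ℕ} (ht : 0 < t) {x : ℝ} :
    x ∈ Set.Ico (0 : ℝ) t ↔ x / t ∈ Set.Ico (0 : ℝ) 1 := by
  have : (0 : ℝ) < t := by exact_mod_cast ht
  rw [Set.mem_Ico, Set.mem_Ico, div_lt_one this, le_div_iff₀ this, zero_mul]

lemma PP_three (t : ℕ) (ht : 0 < t) (a b c : Fin 3 → ℤ) (hD : D3 a b c ≠ 0) :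
    (PP (Set.Ico (0 : ℝ) t) (Set.Ico (0 : ℝ) t) (Set.Ico (0 : ℝ) t) a b c).ncard =
      t ^ 3 * (D3 a b c).natAbs := by
  have ht' : (t : ℝ) ≠ 0 := by exact_mod_cast ht.ne'
  have hd : D3 (fun k => t * a k) (fun k => t * b k) (fun k => t * c k) = t ^ 3 * D3 a b c := by
    unfold D3; ring
  have := PP_unit (fun k => t * a k) (fun k => t * b k) (fun k => t * c k) (by
    rw [hd]; positivity)
  rw [hd, Int.natAbs_mul, Int.natAbs_pow, Int.natAbs_natCast] at this
  rw [← this]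
  congr 1
  ext p
  constructor
  · rintro ⟨x, y, z, hx, hy, hz, h⟩
    refine ⟨x / t, y / t, z / t, (scale_Ico ht).1 hx, (scale_Ico ht).1 hy, (scale_Ico ht).1 hz,
      fun k => ?_⟩
    rw [h k]; push_cast; field_simp
  · rintro ⟨x, y, z, hx, hy, hz, h⟩
    refine ⟨x * t, y * t, z * t, (scale_Ico ht).2 (by rwa [mul_div_cancel_right₀ _ ht']),
      (scale_Ico ht).2 (by rwa [mul_div_cancel_right₀ _ ht']),
      (scale_Ico ht).2 (by rwa [mul_div_cancel_right₀ _ ht']), fun k => ?_⟩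
    rw [h k]; push_cast; ring

lemma bezout3 (v : Fin 3 → ℤ) (hv : dot3 v v ≠ 0) : ∃ w u : Fin 3 → ℤ,
    0 < gcd3 v ∧ (∀ k, v k = gcd3 v * w k) ∧ dot3 w u = 1 := by
  obtain ⟨u, hu⟩ : ∃ u : Fin 3 → ℤ, dot3 v u = gcd3 v := by
    refine ⟨![Int.gcdA (v 0) (Int.gcd (v 1) (v 2)),
      Int.gcdB (v 0) (Int.gcd (v 1) (v 2)) * Int.gcdA (v 1) (v 2),
      Int.gcdB (v 0) (Int.gcd (v 1) (v 2)) * Int.gcdB (v 1) (v 2)], ?_⟩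
    have h1 := Int.gcd_eq_gcd_ab (v 0) (Int.gcd (v 1) (v 2))
    have h2 := Int.gcd_eq_gcd_ab (v 1) (v 2)
    unfold gcd3 dot3
    simp only [Matrix.cons_val]
    linear_combination (-1) * h1 - Int.gcdB (v 0) (Int.gcd (v 1) (v 2)) * h2
  have hdvd : ∀ k, (gcd3 v : ℤ) ∣ v k := by
    have hg : (gcd3 v : ℤ) ∣ Int.gcd (v 1) (v 2) := Int.gcd_dvd_right _ _
    intro k
    fin_cases k
    · exact Int.gcd_dvd_left _ _
    · exact hg.trans (Int.gcd_dvd_left _ _)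
    · exact hg.trans (Int.gcd_dvd_right _ _)
  choose w hw using hdvd
  have hpos : 0 < gcd3 v := by
    rcases Nat.eq_zero_or_pos (gcd3 v) with h | h
    · exfalso
      apply hv
      simp [dot3, hw, h]
    · exact h
  refine ⟨w, u, hpos, hw, ?_⟩
  have h0 : (gcd3 v : ℤ) ≠ 0 := by exact_mod_cast hpos.ne'
  apply mul_left_cancel₀ h0
  rw [mul_one]
  conv_rhs => rw [← hu]
  unfold dot3
  rw [hw 0, hw 1, hw 2]
  ring

lemma PP_one (t : ℕ) (a b c : Fin 3 → ℤ) (ha : dot3 a a ≠ 0) :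
    (PP (Set.Ico (0 : ℝ) t) {0} {0} a b c).ncard = t * gcd3 a := by
  obtain ⟨w, u, hpos, hw, hwu⟩ := bezout3 a ha
  have hpos' : (0 : ℝ) < gcd3 a := by exact_mod_cast hpos
  have e : PP (Set.Ico (0 : ℝ) t) {0} {0} a b c =
      (fun (n : ℤ) k => n * w k) '' (Set.Ico (0 : ℤ) (t * gcd3 a)) := by
    ext p
    constructor
    · rintro ⟨x, y, z, hx, hy, hz, h⟩
      rw [Set.mem_singleton_iff] at hy hz
      have hp : ∀ k, (p k : ℝ) = x * gcd3 a * w k := by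
        intro k
        rw [h k, hy, hz, hw k]
        push_cast
        ring
      have hn : ((dot3 p u : ℤ) : ℝ) = x * gcd3 a := by
        have := congrArg (Int.cast : ℤ → ℝ) hwu
        unfold dot3 at this ⊢
        push_cast at this ⊢
        rw [hp, hp, hp]
        linear_combination (x * gcd3 a) * this
      refine ⟨dot3 p u, ⟨?_, ?_⟩, ?_⟩
      · have : (0 : ℝ) ≤ (dot3 p u : ℤ) := by
          rw [hn]; exact mul_nonneg hx.1 hpos'.le
        exact_mod_cast this
      · have : ((dot3 p u : ℤ) : ℝ) < t * gcd3 a := by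
          rw [hn]; exact mul_lt_mul_of_pos_right hx.2 hpos'
        exact_mod_cast this
      · ext k
        have : ((dot3 p u * w k : ℤ) : ℝ) = p k := by
          push_cast
          rw [hn, hp]
        exact_mod_cast this
    · rintro ⟨n, hn, rfl⟩
      refine ⟨n / gcd3 a, 0, 0, ⟨?_, ?_⟩, rfl, rfl, fun k => ?_⟩
      · have : (0 : ℝ) ≤ n := by exact_mod_cast hn.1
        positivity
      · rw [div_lt_iff₀ hpos']
        exact_mod_cast hn.2
      · rw [hw k]
        push_cast
        field_simp
        ring
  have hinj : Function.Injective (fun (n : ℤ) (k : Fin 3) => n * w k) := by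
    intro m n h
    have h0 := congrFun h 0
    have h1 := congrFun h 1
    have h2 := congrFun h 2
    simp only at h0 h1 h2
    unfold dot3 at hwu
    linear_combination u 0 * h0 + u 1 * h1 + u 2 * h2 + (n - m) * hwu
  rw [e, Set.ncard_image_of_injective _ hinj, ← Finset.coe_Ico, Set.ncard_coe_finset,
    Int.card_Ico]
  simp only [sub_zero]
  exact_mod_cast Int.toNat_natCast (t * gcd3 a)

lemma PP_two (t : ℕ) (ht : 0 < t) (ℓ : ℤ) (hℓ : 0 < ℓ) (a b c : Fin 3 → ℤ)
    (h11 : dot3 a a = ℓ ^ 2) (h22 : dot3 b b = ℓ ^ 2) (h33 : dot3 c c = ℓ ^ 2)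
    (h12 : dot3 a b = 0) (h13 : dot3 a c = 0) (h23 : dot3 b c = 0)
    (hdet : (D3 a b c).natAbs = ℓ ^ 3) :
    ((PP (Set.Ico (0 : ℝ) t) (Set.Ico (0 : ℝ) t) {0} a b c).ncard : ℤ) =
      t ^ 2 * (ℓ * gcd3 c) := by
  have ht' : (t : ℝ) ≠ 0 := by exact_mod_cast ht.ne'
  obtain ⟨w, u, hpos, hw, hwu⟩ := bezout3 c (by rw [h33]; positivity)
  have hpos' : (0 : ℤ) < gcd3 c := by exact_mod_cast hpos
  have hcu : dot3 u c = gcd3 c := by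
    unfold dot3 at hwu ⊢
    rw [hw 0, hw 1, hw 2]
    linear_combination (gcd3 c : ℤ) * hwu
  have hprod : D3 a b u * D3 a b c = ℓ ^ 4 * gcd3 c := by
    have : D3 a b u * D3 a b c = dot3 a a * (dot3 b b * dot3 u c - dot3 b c * dot3 u b)
        - dot3 a b * (dot3 a b * dot3 u c - dot3 b c * dot3 u a)
        + dot3 a c * (dot3 a b * dot3 u b - dot3 b b * dot3 u a) := by
      unfold D3 dot3; ring
    rw [this, h11, h22, h12, h13, h23, hcu]; ring
  have habs : |D3 a b u| = ℓ * gcd3 c := by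
    have h1 := congrArg abs hprod
    rw [abs_mul, ← Int.natCast_natAbs (D3 a b c), hdet,
      abs_of_nonneg (by positivity : 0 ≤ ℓ ^ 4 * (gcd3 c : ℤ))] at h1
    have : ℓ ^ 3 ≠ 0 := by positivity
    apply mul_right_cancel₀ this
    rw [h1]; ring
  have hne : D3 a b u ≠ 0 := by
    intro h0
    rw [h0, abs_zero] at habs
    have : 0 < ℓ * gcd3 c := by positivity
    omega
  have hd : D3 (fun k => t * a k) (fun k => t * b k) u = t ^ 2 * D3 a b u := by
    unfold D3; ring
  have key := PP_unit (fun k => t * a k) (fun k => t * b k) u (by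
    rw [hd]; positivity)
  rw [hd, Int.natAbs_mul, Int.natAbs_pow, Int.natAbs_natCast] at key
  have e : PP (Set.Ico (0 : ℝ) t) (Set.Ico (0 : ℝ) t) {0} a b c =
      PP (Set.Ico (0 : ℝ) 1) (Set.Ico (0 : ℝ) 1) (Set.Ico (0 : ℝ) 1)
        (fun k => t * a k) (fun k => t * b k) u := by
    ext p
    constructor
    · rintro ⟨x, y, z, hx, hy, hz, h⟩
      rw [Set.mem_singleton_iff] at hz
      refine ⟨x / t, y / t, 0, (scale_Ico ht).1 hx, (scale_Ico ht).1 hy, by simp,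
        fun k => ?_⟩
      rw [h k, hz]; push_cast; field_simp; ring
    · rintro ⟨x, y, z, hx, hy, hz, h⟩
      have haw : dot3 a w = 0 := by
        apply mul_left_cancel₀ hpos'.ne'
        unfold dot3 at h13 ⊢
        rw [hw 0, hw 1, hw 2] at h13
        linear_combination h13
      have hbw : dot3 b w = 0 := by
        apply mul_left_cancel₀ hpos'.ne'
        unfold dot3 at h23 ⊢
        rw [hw 0, hw 1, hw 2] at h23
        linear_combination h23
      have hzi : ((dot3 p w : ℤ) : ℝ) = z := by
        have e1 := congrArg (Int.cast : ℤ → ℝ) haw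
        have e2 := congrArg (Int.cast : ℤ → ℝ) hbw
        have e3 := congrArg (Int.cast : ℤ → ℝ) hwu
        unfold dot3 at e1 e2 e3 ⊢
        push_cast at e1 e2 e3 ⊢
        rw [h, h, h]
        push_cast
        linear_combination x * t * e1 + y * t * e2 + z * e3
      have hz0 : z = 0 := by
        rw [← hzi] at hz ⊢
        have h1 : 0 ≤ dot3 p w := by exact_mod_cast hz.1
        have h2 : dot3 p w < 1 := by exact_mod_cast hz.2
        have : dot3 p w = 0 := by omega
        rw [this]; simp
      refine ⟨x * t, y * t, 0, (scale_Ico ht).2 (by rwa [mul_div_cancel_right₀ _ ht']),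
        (scale_Ico ht).2 (by rwa [mul_div_cancel_right₀ _ ht']), rfl, fun k => ?_⟩
      rw [h k, hz0]; push_cast; ring
  rw [e, key]
  push_cast
  rw [habs]

lemma PP_zero (a b c : Fin 3 → ℤ) : (PP {0} {0} {0} a b c).ncard = 1 := by
  rw [Set.ncard_eq_one]
  refine ⟨0, ?_⟩
  ext p
  constructor
  · rintro ⟨x, y, z, hx, hy, hz, h⟩
    rw [Set.mem_singleton_iff] at hx hy hz
    ext k
    have := h k
    rw [hx, hy, hz] at this
    simpa using this
  · rintro rfl
    exact ⟨0, 0, 0, rfl, rfl, rfl, fun k => by simp⟩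

lemma dot3_comm' (a b : Fin 3 → ℤ) : dot3 a b = dot3 b a := by
  unfold dot3; ring

theorem cube_ehrhart_factored (ℓ : ℤ) (hℓ : 0 < ℓ) (v₁ v₂ v₃ : Fin 3 → ℤ)
    (h11 : dot3 v₁ v₁ = ℓ ^ 2) (h22 : dot3 v₂ v₂ = ℓ ^ 2) (h33 : dot3 v₃ v₃ = ℓ ^ 2)
    (h12 : dot3 v₁ v₂ = 0) (h13 : dot3 v₁ v₃ = 0) (h23 : dot3 v₂ v₃ = 0) :
    ∀ t : ℕ, 0 < t →
      (cubeCount v₁ v₂ v₃ t : ℤ) =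
        (ℓ * t + 1) * (ℓ ^ 2 * t ^ 2 + ((gcd3 v₁ : ℤ) + gcd3 v₂ + gcd3 v₃ - ℓ) * t + 1) := by
  intro t ht
  have hsq : D3 v₁ v₂ v₃ ^ 2 = (ℓ ^ 3) ^ 2 := by
    have : D3 v₁ v₂ v₃ ^ 2 = dot3 v₁ v₁ * (dot3 v₂ v₂ * dot3 v₃ v₃ - dot3 v₂ v₃ * dot3 v₂ v₃)
        - dot3 v₁ v₂ * (dot3 v₁ v₂ * dot3 v₃ v₃ - dot3 v₂ v₃ * dot3 v₁ v₃)
        + dot3 v₁ v₃ * (dot3 v₁ v₂ * dot3 v₂ v₃ - dot3 v₂ v₂ * dot3 v₁ v₃) := by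
      unfold D3 dot3; ring
    rw [this, h11, h22, h33, h12, h13, h23]; ring
  have hdet : ((D3 v₁ v₂ v₃).natAbs : ℤ) = ℓ ^ 3 := by
    rw [Int.natCast_natAbs, (sq_eq_sq_iff_abs_eq_abs _ _).1 hsq, abs_of_nonneg (by positivity)]
  have hD : D3 v₁ v₂ v₃ ≠ 0 := by
    intro h0
    rw [h0] at hdet
    have : 0 < ℓ ^ 3 := by positivity
    simp at hdet
    omega
  have hD2 : D3 v₂ v₃ v₁ ≠ 0 := by rwa [D3_rot]
  have hD3 : D3 v₃ v₁ v₂ ≠ 0 := by rwa [D3_rot, D3_rot]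
  have s1 : Set.Icc (0 : ℝ) t ⊆ Set.Icc (0 : ℝ) t := subset_rfl
  have s2 : Set.Ico (0 : ℝ) t ⊆ Set.Icc (0 : ℝ) t := Set.Ico_subset_Icc_self
  have s3 : ({0} : Set ℝ) ⊆ Set.Icc (0 : ℝ) t := by simp
  have hc : cubeCount v₁ v₂ v₃ t =
      (PP (Set.Icc (0 : ℝ) t) (Set.Icc (0 : ℝ) t) (Set.Icc (0 : ℝ) t) v₁ v₂ v₃).ncard := rfl
  have p1 := fun J K hJ hK => PP_split t J K v₁ v₂ v₃ hD hJ hK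
  have p2 := fun J K hJ hK => PP_split t J K v₂ v₃ v₁ hD2 hJ hK
  have p3 := fun J K hJ hK => PP_split t J K v₃ v₁ v₂ hD3 hJ hK
  have A3 := PP_three t ht v₁ v₂ v₃ hD
  have B3 := PP_two t ht ℓ hℓ v₁ v₂ v₃ h11 h22 h33 h12 h13 h23 hdet
  have B1 := PP_two t ht ℓ hℓ v₂ v₃ v₁ h22 h33 h11 h23 (by rwa [dot3_comm'])
    (by rwa [dot3_comm']) (by rwa [D3_rot])
  have B2 := PP_two t ht ℓ hℓ v₃ v₁ v₂ h33 h11 h22 (by rwa [dot3_comm'])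
    (by rwa [dot3_comm']) h12 (by rwa [D3_rot, D3_rot])
  have hl : ℓ ^ 2 ≠ 0 := by positivity
  have C1 := PP_one t v₁ v₂ v₃ (by rwa [h11])
  have C2 := PP_one t v₂ v₃ v₁ (by rwa [h22])
  have C3 := PP_one t v₃ v₁ v₂ (by rwa [h33])
  have Z := PP_zero v₁ v₂ v₃
  -- normalise every count to the order `v₁ v₂ v₃`
  simp only [PP_rot _ _ _ v₃ v₁ v₂] at p3 B2 C3
  simp only [← PP_rot _ _ _ v₁ v₂ v₃] at p2 p3 B1 B2 C2 C3
  rw [hc, p1 _ _ s1 s1, p2 _ _ s1 s2, p2 _ _ s1 s3, p3 _ _ s2 s2, p3 _ _ s2 s3, p3 _ _ s3 s2,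
    p3 _ _ s3 s3]
  push_cast
  rw [A3, B1, B2, B3, C1, C2, C3, Z]
  push_cast [hdet]
  ring
end
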